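/- Let γ ≥ 2 and let (u,θ) be a classical solution of the thermal reduced Burgers system on 𝕋³ × [0,T] with θ₀ ≥ 1 on 𝕋³. Then θ(x,t) ≥ 1/(3t/(8ν) + 1) for all (x,t) ∈ 𝕋³ × [0,T]. -/

import Mathlib

open MeasureTheory Real
open scoped ENNReal

noncomputable section

/-- Points of `ℝ³`; `ℤ³`-periodic functions on `Sp` model functions on the torus `𝕋³`. -/
abbrev Sp : Type := Fin 3 → ℝ

/-- A fundamental cell for the torus `𝕋³ = ℝ³/ℤ³`; integrals over `𝕋³` are integrals
over `cell`. -/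
def cell : Set Sp := Set.Icc 0 1

/-- The `i`-th partial derivative `∂ᵢ f`. -/
def pd (i : Fin 3) (f : Sp → ℝ) (x : Sp) : ℝ := fderiv ℝ f x (Pi.single i 1)

/-- `ℤ³`-periodicity: such a function descends to the torus `𝕋³`. -/
def Periodic3 (f : Sp → ℝ) : Prop :=
  ∀ (x : Sp) (k : Fin 3 → ℤ), f (x + fun i => (k i : ℝ)) = f x

/-- `|∇u|²` for a vector field `u`. -/
def gradSqV (u : Sp → Fin 3 → ℝ) (x : Sp) : ℝ :=
  ∑ i, ∑ j, (pd i (fun y => u y j) x) ^ 2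

/-- `|∇²u|²` for a vector field `u`. -/
def hessSqV (u : Sp → Fin 3 → ℝ) (x : Sp) : ℝ :=
  ∑ i, ∑ j, ∑ k, (pd i (pd j (fun y => u y k)) x) ^ 2

/-- `|∇f|²` for a scalar field `f`. -/
def gradSqS (f : Sp → ℝ) (x : Sp) : ℝ := ∑ i, (pd i f x) ^ 2

/-- A classical solution `(u, θ)` of the thermal reduced Burgers system
`∂ₜuⱼ + uᵢ∂ᵢuⱼ + (1/γ)uⱼ∂ᵢuᵢ − ν∂ᵢ(θ∂ᵢuⱼ) = 0`,
`∂ₜ(θ²) + ∂ᵢ(uᵢθ²) − κ∂ᵢ(θ∂ᵢ(θ²)) = νθ|∇u|²` on `𝕋³ × [0,T]`, with `θ₀ ≥ 1`. -/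
structure ThermalBurgers (ν κ γ T : ℝ) (u : ℝ → Sp → Fin 3 → ℝ)
    (θ : ℝ → Sp → ℝ) : Prop where
  T_pos : 0 < T
  smooth_u : ContDiff ℝ (⊤ : ℕ∞) fun q : ℝ × Sp => u q.1 q.2
  smooth_θ : ContDiff ℝ (⊤ : ℕ∞) fun q : ℝ × Sp => θ q.1 q.2
  periodic_u : ∀ t j, Periodic3 fun x => u t x j
  periodic_θ : ∀ t, Periodic3 (θ t)
  momentum : ∀ t ∈ Set.Icc (0 : ℝ) T, ∀ x, ∀ j,
    deriv (fun s => u s x j) t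
      + (∑ i, u t x i * pd i (fun y => u t y j) x)
      + (1 / γ) * u t x j * (∑ i, pd i (fun y => u t y i) x)
      - ν * ∑ i, pd i (fun y => θ t y * pd i (fun z => u t z j) y) x = 0
  heat : ∀ t ∈ Set.Icc (0 : ℝ) T, ∀ x,
    deriv (fun s => θ s x ^ 2) t
      + (∑ i, pd i (fun y => u t y i * θ t y ^ 2) x)
      - κ * (∑ i, pd i (fun y => θ t y * pd i (fun z => θ t z ^ 2) y) x)
      = ν * θ t x * gradSqV (u t) x
  θ0_ge_one : ∀ x, 1 ≤ θ 0 x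

/-- Second derivative test, necessary condition. -/
theorem IsLocalMin.deriv_deriv_nonneg {f : ℝ → ℝ} {a : ℝ} (h : IsLocalMin f a)
    (hc : ContinuousAt f a) : 0 ≤ deriv (deriv f) a := by
  by_contra! hneg
  have hmax := isLocalMax_of_deriv_deriv_neg hneg h.deriv_eq_zero hc
  have heq : f =ᶠ[nhds a] fun _ => f a := by
    filter_upwards [h, hmax] with x h1 h2
    exact le_antisymm h2 h1
  have := heq.deriv.deriv_eq
  simp at this
  linarith

/-- A function that is nonnegative to the left of one of its zeros has nonpositive derivative
there. -/
theorem HasDerivAt.nonpos_of_nonneg_left {f : ℝ → ℝ} {f' a : ℝ} (hf : HasDerivAt f f' a)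
    (h0 : f a = 0) (h : ∀ᶠ s in nhdsWithin a (Set.Iio a), 0 ≤ f s) : f' ≤ 0 := by
  have ht := hf.hasDerivWithinAt (s := Set.Iio a)
  rw [hasDerivWithinAt_iff_tendsto_slope' (by simp)] at ht
  refine le_of_tendsto ht ?_
  filter_upwards [h, self_mem_nhdsWithin] with s hs hlt
  rw [slope_def_field, h0, sub_zero]
  exact div_nonpos_of_nonneg_of_nonpos hs (by simpa using (Set.mem_Iio.1 hlt).le)

theorem pd_mul {f g : Sp → ℝ} {x : Sp} (i : Fin 3) (hf : DifferentiableAt ℝ f x)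
    (hg : DifferentiableAt ℝ g x) :
    pd i (fun y => f y * g y) x = f x * pd i g x + g x * pd i f x := by
  simp [pd, fderiv_fun_mul hf hg]

theorem contDiff_pd {f : Sp → ℝ} (hf : ContDiff ℝ (⊤ : ℕ∞) f) (i : Fin 3) :
    ContDiff ℝ (⊤ : ℕ∞) (pd i f) :=
  (hf.fderiv_right (m := (⊤ : ℕ∞)) (by norm_cast)).clm_apply contDiff_const

theorem IsLocalMin.pd_eq_zero {f : Sp → ℝ} {x : Sp} (h : IsLocalMin f x) (i : Fin 3) :
    pd i f x = 0 := by
  simp [pd, h.fderiv_eq_zero]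

theorem deriv_comp_line {f : Sp → ℝ} (hf : Differentiable ℝ f) (x : Sp) (i : Fin 3) (s : ℝ) :
    deriv (fun r : ℝ => f (x + r • Pi.single i 1)) s = pd i f (x + s • Pi.single i 1) := by
  have hl : HasDerivAt (fun r : ℝ => x + r • (Pi.single i 1 : Sp)) (Pi.single i 1) s := by
    simpa using ((hasDerivAt_id s).smul_const (Pi.single i 1 : Sp)).const_add x
  exact ((hf _).hasFDerivAt.comp_hasDerivAt s hl).deriv

theorem IsLocalMin.pd_pd_nonneg {f : Sp → ℝ} {x : Sp} (h : IsLocalMin f x)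
    (hf : ContDiff ℝ (⊤ : ℕ∞) f) (i : Fin 3) : 0 ≤ pd i (pd i f) x := by
  have hline : Continuous fun r : ℝ => x + r • (Pi.single i 1 : Sp) := by fun_prop
  have hmin : IsLocalMin (fun r : ℝ => f (x + r • Pi.single i 1)) 0 := by
    have ht : Filter.Tendsto (fun r : ℝ => x + r • (Pi.single i 1 : Sp)) (nhds 0) (nhds x) := by
      simpa using hline.tendsto 0
    filter_upwards [ht.eventually h] with r hr
    simpa using hr
  have key := hmin.deriv_deriv_nonneg (hf.continuous.comp hline).continuousAt
  rw [funext (deriv_comp_line (hf.differentiable (by simp)) x i),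
    deriv_comp_line ((contDiff_pd hf i).differentiable (by simp))] at key
  simpa using key

theorem Periodic3.exists_mem_cell {f : Sp → ℝ} (hf : Periodic3 f) (x : Sp) :
    ∃ y ∈ cell, f y = f x := by
  refine ⟨x + fun i => ((-⌊x i⌋ : ℤ) : ℝ), ⟨fun i => ?_, fun i => ?_⟩, hf x _⟩
  · simpa using Int.floor_le (x i)
  · have := Int.lt_floor_add_one (x i)
    simp
    linarith

theorem sq_sum_pd_le_gradSqV (u : Sp → Fin 3 → ℝ) (x : Sp) :
    (∑ i, pd i (fun y => u y i) x) ^ 2 ≤ 3 * gradSqV u x := by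
  have h1 : (∑ i, pd i (fun y => u y i) x) ^ 2 ≤ 3 * ∑ i, (pd i (fun y => u y i) x) ^ 2 := by
    simpa using sq_sum_le_card_mul_sum_sq (s := Finset.univ) (f := fun i => pd i (fun y => u y i) x)
  have h2 : ∑ i, (pd i (fun y => u y i) x) ^ 2 ≤ gradSqV u x :=
    Finset.sum_le_sum fun i _ => Finset.single_le_sum
      (f := fun j => (pd i (fun y => u y j) x) ^ 2) (fun j _ => sq_nonneg _) (Finset.mem_univ i)
  linarith

/-- The differential inequality `∂ₜθ ≥ -3θ²/(8ν)` at a positive spatial minimum of `θ`. -/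
theorem ThermalBurgers.deriv_ge_of_isMin {ν κ γ T : ℝ} {u : ℝ → Sp → Fin 3 → ℝ}
    {θ : ℝ → Sp → ℝ} (h : ThermalBurgers ν κ γ T u θ) (hν : 0 < ν) (hκ : 0 < κ) {t : ℝ}
    (ht : t ∈ Set.Icc 0 T) {x : Sp} (hpos : 0 < θ t x) (hmin : ∀ y, θ t x ≤ θ t y) :
    -(3 / (8 * ν)) * θ t x ^ 2 ≤ deriv (fun s => θ s x) t := by
  have hθ : ContDiff ℝ (⊤ : ℕ∞) (θ t) :=
    h.smooth_θ.comp (contDiff_const.prodMk contDiff_id)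
  have hu : ∀ i, ContDiff ℝ (⊤ : ℕ∞) fun y => u t y i := fun i =>
    (contDiff_apply ℝ ℝ i).comp (h.smooth_u.comp (contDiff_const.prodMk contDiff_id))
  have hθt : ContDiff ℝ (⊤ : ℕ∞) fun s => θ s x :=
    h.smooth_θ.comp (contDiff_id.prodMk contDiff_const)
  have hsq : ContDiff ℝ (⊤ : ℕ∞) fun y => θ t y ^ 2 := hθ.pow 2
  have hsqmin : IsLocalMin (fun y => θ t y ^ 2) x :=
    Filter.Eventually.of_forall fun y => pow_le_pow_left₀ hpos.le (hmin y) 2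
  have hdt : deriv (fun s => θ s x ^ 2) t = 2 * θ t x * deriv (fun s => θ s x) t := by
    rw [deriv_fun_pow (hθt.differentiable (by simp) t)]
    simp
  have hconv : ∑ i, pd i (fun y => u t y i * θ t y ^ 2) x
      = θ t x ^ 2 * ∑ i, pd i (fun y => u t y i) x := by
    rw [Finset.mul_sum]
    refine Finset.sum_congr rfl fun i _ => ?_
    rw [pd_mul i ((hu i).differentiable (by simp) x) (hsq.differentiable (by simp) x),
      hsqmin.pd_eq_zero]
    ring
  have hdiff : 0 ≤ ∑ i, pd i (fun y => θ t y * pd i (fun z => θ t z ^ 2) y) x := by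
    refine Finset.sum_nonneg fun i _ => ?_
    rw [pd_mul i (hθ.differentiable (by simp) x)
      ((contDiff_pd hsq i).differentiable (by simp) x), hsqmin.pd_eq_zero, zero_mul, add_zero]
    exact mul_nonneg hpos.le (hsqmin.pd_pd_nonneg hsq i)
  have heat := h.heat t ht x
  rw [hdt, hconv] at heat
  have hG := sq_sum_pd_le_gradSqV (u t) x
  set d := ∑ i, pd i (fun y => u t y i) x
  set a := θ t x
  set D := deriv (fun s => θ s x) t
  have h1 : 0 ≤ a * (2 * D + a * d - ν * gradSqV (u t) x) := by
    have := mul_nonneg hκ.le hdiff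
    linarith
  have h2 := nonneg_of_mul_nonneg_right h1 hpos
  have h3 : ν * d ^ 2 ≤ ν * (3 * gradSqV (u t) x) := mul_le_mul_of_nonneg_left hG hν.le
  have h4 : 0 ≤ 8 * ν * D + 3 * a ^ 2 := by
    nlinarith [sq_nonneg (2 * ν * d - 3 * a), mul_nonneg hν.le h2,
      mul_le_mul_of_nonneg_left h3 hν.le]
  have h5 : 0 ≤ (8 * ν * D + 3 * a ^ 2) / (8 * ν) := by positivity
  have h6 : (8 * ν * D + 3 * a ^ 2) / (8 * ν) = D + 3 / (8 * ν) * a ^ 2 := by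
    field_simp
  linarith

/-- Strict comparison of `θ` with the slightly faster decaying barrier
`1 / (1 + ε + (3 / (8ν) + ε) t)`. -/
theorem ThermalBurgers.barrier_lt {ν κ γ T : ℝ} {u : ℝ → Sp → Fin 3 → ℝ}
    {θ : ℝ → Sp → ℝ} (h : ThermalBurgers ν κ γ T u θ) (hν : 0 < ν) (hκ : 0 < κ) {ε : ℝ}
    (hε : 0 < ε) {t : ℝ} (ht : t ∈ Set.Icc 0 T) (x : Sp) :
    (1 + ε + (3 / (8 * ν) + ε) * t)⁻¹ < θ t x := by
  set c := 3 / (8 * ν) + ε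
  have hc : 0 < c := by positivity
  set φ : ℝ → ℝ := fun s => (1 + ε + c * s)⁻¹
  have hden : ∀ s, 0 ≤ s → 0 < 1 + ε + c * s := fun s hs => by positivity
  change φ t < θ t x
  by_contra! hle
  have hθc : Continuous fun q : ℝ × Sp => θ q.1 q.2 := h.smooth_θ.continuous
  have hφc : ContinuousOn φ (Set.Icc 0 T) := by
    refine ContinuousOn.inv₀ (by fun_prop) fun s hs => (hden s hs.1).ne'
  have hK : IsCompact (Set.Icc 0 T ×ˢ cell) := isCompact_Icc.prod isCompact_Icc
  set S : Set (ℝ × Sp) := {q ∈ Set.Icc 0 T ×ˢ cell | θ q.1 q.2 ≤ φ q.1}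
  have hS : IsCompact S := hK.of_isClosed_subset
    (hK.isClosed.isClosed_le hθc.continuousOn
      (hφc.comp continuousOn_fst fun q hq => hq.1)) fun q hq => hq.1
  obtain ⟨x', hx', hxx⟩ := (h.periodic_θ t).exists_mem_cell x
  obtain ⟨⟨t₀, x₀⟩, ⟨⟨ht₀, hx₀⟩, hle₀⟩, hfirst⟩ := hS.exists_isMinOn
    ⟨(t, x'), ⟨ht, hx'⟩, hxx.trans_le hle⟩ continuous_fst.continuousOn
  simp only at ht₀ hx₀ hle₀
  have hbefore : ∀ s, 0 ≤ s → s < t₀ → ∀ y, φ s < θ s y := by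
    intro s hs hst y
    by_contra! hy
    obtain ⟨y', hy', hyy⟩ := (h.periodic_θ s).exists_mem_cell y
    have hmem : (s, y') ∈ S := ⟨⟨⟨hs, hst.le.trans ht₀.2⟩, hy'⟩, hyy.trans_le hy⟩
    exact absurd (hfirst hmem) (not_le.2 hst)
  have ht₀pos : 0 < t₀ := by
    refine ht₀.1.lt_of_ne fun h0 => ?_
    subst h0
    have h1 := h.θ0_ge_one x₀
    have h2 : φ 0 < 1 := inv_lt_one_of_one_lt₀ (by simpa using hε)
    linarith
  have hφd : HasDerivAt φ (-c * φ t₀ ^ 2) t₀ := by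
    have h1 : HasDerivAt (fun s => 1 + ε + c * s) c t₀ := by
      simpa using ((hasDerivAt_id t₀).const_mul c).const_add (1 + ε)
    refine (h1.inv (hden t₀ ht₀.1).ne').congr_deriv ?_
    simp only [φ, inv_pow, div_eq_mul_inv]
  have hθt : ∀ y, ContDiff ℝ (⊤ : ℕ∞) fun s => θ s y := fun y =>
    h.smooth_θ.comp (contDiff_id.prodMk contDiff_const)
  have hleft : ∀ᶠ s in nhdsWithin t₀ (Set.Iio t₀), ∀ y, φ s < θ s y := by
    filter_upwards [Ioo_mem_nhdsLT ht₀pos] with s hs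
    exact hbefore s hs.1.le hs.2
  have hge : ∀ y, φ t₀ ≤ θ t₀ y := fun y =>
    le_of_tendsto_of_tendsto (hφd.continuousAt.tendsto.mono_left nhdsWithin_le_nhds)
      ((hθt y).continuous.continuousAt.tendsto.mono_left nhdsWithin_le_nhds)
      (hleft.mono fun s hs => (hs y).le)
  have heq : θ t₀ x₀ = φ t₀ := le_antisymm hle₀ (hge x₀)
  have hφpos : 0 < φ t₀ := inv_pos.2 (hden t₀ ht₀.1)
  have hlow := h.deriv_ge_of_isMin hν hκ ht₀ (x := x₀) (heq ▸ hφpos) fun y => heq ▸ hge y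
  have hup := (((hθt x₀).differentiable (by simp) t₀).hasDerivAt.sub hφd).nonpos_of_nonneg_left
    (by simp [heq]) (hleft.mono fun s hs => by simpa using (hs x₀).le)
  rw [heq] at hlow
  have : 0 < ε * φ t₀ ^ 2 := by positivity
  simp only [c] at hup
  linarith

/-- **Proposition 3.1 (weak minimum principle), thermal reduced Burgers.** If `θ₀ ≥ 1`,
then `θ(x,t) ≥ 1/(3t/(8ν) + 1)` on `𝕋³ × [0,T]`. -/
theorem thermalBurgers_temperature_lower_bound (ν κ γ T : ℝ) (hν : 0 < ν) (hκ : 0 < κ)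
    (hγ : 2 ≤ γ) (u : ℝ → Sp → Fin 3 → ℝ) (θ : ℝ → Sp → ℝ)
    (h : ThermalBurgers ν κ γ T u θ) :
    ∀ t ∈ Set.Icc (0 : ℝ) T, ∀ x : Sp,
      1 / (3 * t / (8 * ν) + 1) ≤ θ t x := by
  intro t ht x
  have hden : 3 * t / (8 * ν) + 1 ≠ 0 := by
    have := ht.1
    positivity
  have hlim : Filter.Tendsto (fun ε : ℝ => (1 + ε + (3 / (8 * ν) + ε) * t)⁻¹)
      (nhdsWithin 0 (Set.Ioi 0)) (nhds (1 / (3 * t / (8 * ν) + 1))) := by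
    have hval : 1 + 0 + (3 / (8 * ν) + 0) * t = 3 * t / (8 * ν) + 1 := by ring
    have hcont : ContinuousAt (fun ε : ℝ => (1 + ε + (3 / (8 * ν) + ε) * t)⁻¹) 0 :=
      ContinuousAt.inv₀ (by fun_prop) (by rwa [hval])
    have := hcont.tendsto.mono_left (nhdsWithin_le_nhds (s := Set.Ioi 0))
    rwa [hval, inv_eq_one_div] at this
  refine le_of_tendsto hlim ?_
  filter_upwards [self_mem_nhdsWithin] with ε hε
  exact (h.barrier_lt hν hκ hε ht x).le
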